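/- Let G be an affine supergroup (supercommutative Hopf superalgebra K[G]) and let N ≤ G be a supersubgroup whose defining superideal satisfies I_N = K[G]T⁺ + K[G]s(T⁺), where T = K[G]^N is the invariant subalgebra and T⁺ = T ∩ ker ε. Then for any supercommutative superalgebra A and any g₁, g₂ ∈ G(A) = Hom_{SAlg}(K[G], A): if g₁ and g₂ agree on T, then g₁⁻¹g₂ (product in the group G(A), i.e. convolution) vanishes on I_N, i.e. g₁ N(A) = g₂ N(A). -/

import Mathlib

open TensorProduct

/-- The signed braiding `a ⊗ b ↦ (-1)^{|a||b|} b ⊗ a` on `A ⊗ A` for a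
`ℤ/2`-graded algebra `A`. -/
noncomputable def superSwap {K A : Type} [Field K] [Ring A] [Algebra K A]
    (𝒜 : ZMod 2 → Submodule K A) [GradedAlgebra 𝒜] :
    A ⊗[K] A →ₗ[K] A ⊗[K] A :=
  ∑ p : ZMod 2 × ZMod 2, ((-1 : K) ^ (p.1.val * p.2.val)) •
    ((TensorProduct.comm K A A).toLinearMap ∘ₗ
      TensorProduct.map (GradedAlgebra.proj 𝒜 p.1) (GradedAlgebra.proj 𝒜 p.2))

/-- The super multiplication on `A ⊗ A`:
`(a ⊗ b) ⊗ (c ⊗ d) ↦ (-1)^{|b||c|} (ac) ⊗ (bd)`. -/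
noncomputable def superMulAA {K A : Type} [Field K] [Ring A] [Algebra K A]
    (𝒜 : ZMod 2 → Submodule K A) [GradedAlgebra 𝒜] :
    (A ⊗[K] A) ⊗[K] (A ⊗[K] A) →ₗ[K] A ⊗[K] A :=
  TensorProduct.map (LinearMap.mul' K A) (LinearMap.mul' K A) ∘ₗ
    (TensorProduct.assoc K A A (A ⊗[K] A)).symm.toLinearMap ∘ₗ
    TensorProduct.map LinearMap.id (TensorProduct.assoc K A A A).toLinearMap ∘ₗ
    TensorProduct.map LinearMap.id (TensorProduct.map (superSwap 𝒜) LinearMap.id) ∘ₗ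
    TensorProduct.map LinearMap.id (TensorProduct.assoc K A A A).symm.toLinearMap ∘ₗ
    (TensorProduct.assoc K A A (A ⊗[K] A)).toLinearMap

/-- A (supercommutative) Hopf superalgebra structure on a `ℤ/2`-graded algebra `A`:
comultiplication, counit and antipode, satisfying the Hopf superalgebra axioms, where
the compatibility of the comultiplication with the product uses the sign rule. -/
structure SuperHopf (K A : Type) [Field K] [Ring A] [Algebra K A]
    (𝒜 : ZMod 2 → Submodule K A) [GradedAlgebra 𝒜] where
  comul : A →ₗ[K] A ⊗[K] A
  counit : A →ₗ[K] K
  antipode : A →ₗ[K] A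
  coassoc : (TensorProduct.assoc K A A A).toLinearMap ∘ₗ
      TensorProduct.map comul LinearMap.id ∘ₗ comul
      = TensorProduct.map LinearMap.id comul ∘ₗ comul
  counit_left : (TensorProduct.lid K A).toLinearMap ∘ₗ
      TensorProduct.map counit LinearMap.id ∘ₗ comul = LinearMap.id
  counit_right : (TensorProduct.rid K A).toLinearMap ∘ₗ
      TensorProduct.map LinearMap.id counit ∘ₗ comul = LinearMap.id
  comul_one : comul 1 = (1 : A) ⊗ₜ[K] 1
  counit_one : counit 1 = 1
  comul_mul : comul ∘ₗ LinearMap.mul' K A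
      = superMulAA 𝒜 ∘ₗ TensorProduct.map comul comul
  counit_mul : ∀ a b : A, counit (a * b) = counit a * counit b
  antipode_left : LinearMap.mul' K A ∘ₗ
      TensorProduct.map antipode LinearMap.id ∘ₗ comul
      = Algebra.linearMap K A ∘ₗ counit
  antipode_right : LinearMap.mul' K A ∘ₗ
      TensorProduct.map LinearMap.id antipode ∘ₗ comul
      = Algebra.linearMap K A ∘ₗ counit
  comul_graded : ∀ (i : ZMod 2) (x : A), x ∈ 𝒜 i →
      comul x ∈ ⨆ j : ZMod 2, LinearMap.range
        (TensorProduct.map ((𝒜 j).subtype) ((𝒜 (i - j)).subtype))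
  antipode_graded : ∀ (i : ZMod 2) (x : A), x ∈ 𝒜 i → antipode x ∈ 𝒜 i

section Helpers

variable {K A B : Type} [Field K] [Ring A] [Algebra K A]
  {𝒜 : ZMod 2 → Submodule K A} [GradedAlgebra 𝒜] [Ring B] [Algebra K B]

/-- convolution -/
noncomputable def cnv (H : SuperHopf K A 𝒜) (f g : A →ₗ[K] B) : A →ₗ[K] B :=
  LinearMap.mul' K B ∘ₗ TensorProduct.map f g ∘ₗ H.comul

/-- convolution unit scaled by an element -/
noncomputable def cu (H : SuperHopf K A 𝒜) (b : B) : A →ₗ[K] B :=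
  H.counit.smulRight b

theorem cnv_assoc (H : SuperHopf K A 𝒜) (f g h : A →ₗ[K] B) :
    cnv H (cnv H f g) h = cnv H f (cnv H g h) := by
  have h1 : ∀ u : A ⊗[K] A, LinearMap.mul' K B (TensorProduct.map (cnv H f g) h u) =
      (LinearMap.mul' K B ∘ₗ TensorProduct.map f (LinearMap.mul' K B ∘ₗ TensorProduct.map g h))
        (TensorProduct.assoc K A A A (TensorProduct.map H.comul LinearMap.id u)) := by
    intro u
    induction u with
    | zero => simp
    | add x y hx hy => simp only [map_add, hx, hy]
    | tmul x y =>
      simp only [cnv, TensorProduct.map_tmul, LinearMap.comp_apply, LinearMap.id_apply]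
      induction H.comul x with
      | zero => simp
      | add x y hx hy => simp only [map_add, TensorProduct.add_tmul, hx, hy]
      | tmul a b => simp [mul_assoc]
  have h2 : ∀ u : A ⊗[K] A, LinearMap.mul' K B (TensorProduct.map f (cnv H g h) u) =
      (LinearMap.mul' K B ∘ₗ TensorProduct.map f (LinearMap.mul' K B ∘ₗ TensorProduct.map g h))
        (TensorProduct.map LinearMap.id H.comul u) := by
    intro u
    induction u with
    | zero => simp
    | add x y hx hy => simp only [map_add, hx, hy]
    | tmul x y => simp [cnv]
  ext x
  have := LinearMap.congr_fun H.coassoc x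
  simp only [LinearMap.comp_apply, LinearEquiv.coe_coe] at this
  show LinearMap.mul' K B (TensorProduct.map (cnv H f g) h _) =
    LinearMap.mul' K B (TensorProduct.map f (cnv H g h) _)
  rw [h1, h2, this]

theorem cu_cnv (H : SuperHopf K A 𝒜) (b : B) (f : A →ₗ[K] B) :
    cnv H (cu H b) f = LinearMap.mulLeft K b ∘ₗ f := by
  ext x
  have h1 : ∀ u : A ⊗[K] A, LinearMap.mul' K B (TensorProduct.map (cu H b) f u) =
      b * f (TensorProduct.lid K A (TensorProduct.map H.counit LinearMap.id u)) := by
    intro u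
    induction u with
    | zero => simp
    | add x y hx hy => simp only [map_add, hx, hy, mul_add]
    | tmul x y => simp [cu]
  have := LinearMap.congr_fun H.counit_left x
  simp only [LinearMap.comp_apply, LinearEquiv.coe_coe, LinearMap.id_apply] at this
  show LinearMap.mul' K B (TensorProduct.map (cu H b) f _) = _
  rw [h1, this]; rfl

theorem cnv_cu (H : SuperHopf K A 𝒜) (b : B) (f : A →ₗ[K] B) :
    cnv H f (cu H b) = LinearMap.mulRight K b ∘ₗ f := by
  ext x
  have h1 : ∀ u : A ⊗[K] A, LinearMap.mul' K B (TensorProduct.map f (cu H b) u) =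
      f (TensorProduct.rid K A (TensorProduct.map LinearMap.id H.counit u)) * b := by
    intro u
    induction u with
    | zero => simp
    | add x y hx hy => simp only [map_add, hx, hy, add_mul]
    | tmul x y => simp [cu]
  have := LinearMap.congr_fun H.counit_right x
  simp only [LinearMap.comp_apply, LinearEquiv.coe_coe, LinearMap.id_apply] at this
  show LinearMap.mul' K B (TensorProduct.map f (cu H b) _) = _
  rw [h1, this]; rfl

theorem comp_cnv {C : Type} [Ring C] [Algebra K C] (H : SuperHopf K A 𝒜) (φ : B →ₗ[K] C)
    (hφ : ∀ x y, φ (x * y) = φ x * φ y) (f g : A →ₗ[K] B) :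
    φ ∘ₗ cnv H f g = cnv H (φ ∘ₗ f) (φ ∘ₗ g) := by
  ext x
  simp only [cnv, LinearMap.comp_apply]
  induction H.comul x with
  | zero => simp
  | add x y hx hy => simp only [map_add, hx, hy]
  | tmul a b => simp [hφ]

theorem comp_cu {C : Type} [Ring C] [Algebra K C] (H : SuperHopf K A 𝒜) (φ : B →ₗ[K] C)
    (b : B) : φ ∘ₗ cu H b = cu H (φ b) := by
  ext x; simp [cu]

theorem anti_left (H : SuperHopf K A 𝒜) : cnv H H.antipode LinearMap.id = cu H 1 := by
  unfold cnv; rw [H.antipode_left]; ext x; simp [cu, Algebra.algebraMap_eq_smul_one]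

theorem anti_right (H : SuperHopf K A 𝒜) : cnv H LinearMap.id H.antipode = cu H 1 := by
  unfold cnv; rw [H.antipode_right]; ext x; simp [cu, Algebra.algebraMap_eq_smul_one]

variable (𝒜) in
/-- the parity twist -/
noncomputable def tw (j : ZMod 2) : A →ₗ[K] A :=
  ∑ i : ZMod 2, ((-1 : K) ^ (i.val * j.val)) • (GradedAlgebra.proj 𝒜 i)

theorem proj_of_mem (i j : ZMod 2) (x : A) (hx : x ∈ 𝒜 i) :
    GradedAlgebra.proj 𝒜 j x = if i = j then x else 0 := by
  rw [GradedAlgebra.proj_apply]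
  split_ifs with h
  · subst h; exact DirectSum.decompose_of_mem_same 𝒜 hx
  · exact DirectSum.decompose_of_mem_ne 𝒜 hx h

theorem tw_of_mem (i j : ZMod 2) (x : A) (hx : x ∈ 𝒜 i) :
    tw 𝒜 j x = ((-1 : K) ^ (i.val * j.val)) • x := by
  simp [tw, LinearMap.sum_apply, proj_of_mem i _ x hx]

theorem tw_one (j : ZMod 2) : tw 𝒜 j 1 = 1 := by
  rw [tw_of_mem 0 j 1 (SetLike.GradedOne.one_mem)]; simp

theorem hom_ind {P : A → Prop} (hadd : ∀ x y, P x → P y → P (x + y))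
    (hom : ∀ i, ∀ x ∈ 𝒜 i, P x) (x : A) : P x :=
  DirectSum.Decomposition.inductionOn 𝒜 (motive := P) (hom 0 0 (zero_mem _))
    (fun {i} m => hom i m m.2) hadd x

theorem sgn_add (i i' j : ZMod 2) : ((-1 : K) ^ ((i + i').val * j.val)) =
    ((-1 : K) ^ (i.val * j.val)) * ((-1 : K) ^ (i'.val * j.val)) := by
  have h : ∀ i i' j : ZMod 2, ((i + i').val * j.val) % 2 =
      (i.val * j.val + i'.val * j.val) % 2 := by decide
  rw [← pow_add, neg_one_pow_eq_pow_mod_two, h, ← neg_one_pow_eq_pow_mod_two]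

theorem tw_mul (j : ZMod 2) (x y : A) : tw 𝒜 j (x * y) = tw 𝒜 j x * tw 𝒜 j y := by
  induction x using hom_ind (𝒜 := 𝒜) with
  | hadd x y hx hy => simp only [add_mul, map_add, hx, hy]
  | hom i x hx =>
    induction y using hom_ind (𝒜 := 𝒜) with
    | hadd x y hx hy => simp only [mul_add, map_add, hx, hy]
    | hom i' y hy =>
      rw [tw_of_mem _ _ _ (SetLike.GradedMul.mul_mem hx hy), tw_of_mem _ _ _ hx,
        tw_of_mem _ _ _ hy, sgn_add, smul_mul_smul_comm]

theorem superMul_tmul (x y z w : A) : superMulAA 𝒜 ((x ⊗ₜ[K] y) ⊗ₜ[K] (z ⊗ₜ[K] w)) =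
    ∑ p : ZMod 2 × ZMod 2, ((-1 : K) ^ (p.1.val * p.2.val)) •
      ((x * GradedAlgebra.proj 𝒜 p.2 z) ⊗ₜ[K] (GradedAlgebra.proj 𝒜 p.1 y * w)) := by
  simp [superMulAA, superSwap, LinearMap.sum_apply, TensorProduct.sum_tmul,
    TensorProduct.tmul_sum, TensorProduct.smul_tmul', TensorProduct.tmul_smul, -GradedAlgebra.proj_apply]

theorem superMul_hom (i j : ZMod 2) (x y z w : A) (hy : y ∈ 𝒜 i) (hz : z ∈ 𝒜 j) :
    superMulAA 𝒜 ((x ⊗ₜ[K] y) ⊗ₜ[K] (z ⊗ₜ[K] w)) =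
     ((-1 : K) ^ (i.val * j.val)) • ((x * z) ⊗ₜ[K] (y * w)) := by
  rw [superMul_tmul, Finset.sum_eq_single (i, j)]
  · simp [proj_of_mem _ _ _ hy, proj_of_mem _ _ _ hz, -GradedAlgebra.proj_apply]
  · rintro ⟨a, b⟩ - hne
    rw [proj_of_mem _ _ _ hy, proj_of_mem _ _ _ hz]
    by_cases h1 : i = a
    · have : j ≠ b := by rintro rfl; exact hne (by rw [h1])
      simp [this]
    · simp [h1]
  · simp

theorem superMul_tw (j : ZMod 2) (x y z w : A) (hz : z ∈ 𝒜 j) :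
    superMulAA 𝒜 ((x ⊗ₜ[K] y) ⊗ₜ[K] (z ⊗ₜ[K] w)) = (x * z) ⊗ₜ[K] (tw 𝒜 j y * w) := by
  induction y using hom_ind (𝒜 := 𝒜) with
  | hadd a b ha hb =>
    simp only [TensorProduct.tmul_add, TensorProduct.add_tmul, map_add, add_mul, ha, hb]
  | hom i y hy =>
    rw [superMul_hom i j x y z w hy hz, tw_of_mem i j y hy, smul_mul_assoc,
      TensorProduct.tmul_smul]

theorem comul_mul' (H : SuperHopf K A 𝒜) (a b : A) :
    H.comul (a * b) = superMulAA 𝒜 (H.comul a ⊗ₜ[K] H.comul b) := by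
  simpa using LinearMap.congr_fun H.comul_mul (a ⊗ₜ[K] b)

/-- The auxiliary map `b ↦ ∑ s(a₁ b) σ^{|b|}(a₂)`. -/
noncomputable def Fa (H : SuperHopf K A 𝒜) (a : A) : A →ₗ[K] A :=
  ∑ j : ZMod 2, (LinearMap.mul' K A ∘ₗ
    (TensorProduct.map H.antipode (tw 𝒜 j)) ∘ₗ
      ((LinearMap.mul' K A ∘ₗ (TensorProduct.comm K A A).toLinearMap).rTensor A) ∘ₗ
        (TensorProduct.assoc K A A A).symm.toLinearMap ∘ₗ
        (TensorProduct.mk K A (A ⊗[K] A)).flip (H.comul a)) ∘ₗ GradedAlgebra.proj 𝒜 j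

theorem Fa_hom (H : SuperHopf K A 𝒜) (a b : A) (j : ZMod 2) (hb : b ∈ 𝒜 j) :
    Fa H a b = cnv H (H.antipode ∘ₗ LinearMap.mulRight K b) (tw 𝒜 j) a := by
  rw [Fa, LinearMap.sum_apply, Finset.sum_eq_single j]
  · simp only [LinearMap.comp_apply, proj_of_mem j j b hb, if_true, cnv]
    induction H.comul a with
    | zero => simp
    | add x y hx hy => simp only [map_add, LinearMap.add_apply, hx, hy]
    | tmul x y => simp
  · intro i _ hi
    rw [LinearMap.comp_apply, proj_of_mem j i b hb, if_neg (Ne.symm hi), map_zero]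
  · simp

theorem Fa_cnv (H : SuperHopf K A 𝒜) (a : A) :
    cnv H (Fa H a) LinearMap.id = cu H (algebraMap K A (H.counit a)) := by
  ext b
  have key : ∀ v : A ⊗[K] A, LinearMap.mul' K A (TensorProduct.map (Fa H a) LinearMap.id v) =
      LinearMap.mul' K A (TensorProduct.map H.antipode LinearMap.id
        (superMulAA 𝒜 (H.comul a ⊗ₜ[K] v))) := by
    intro v
    induction v with
    | zero => simp
    | add x y hx hy => simp only [map_add, TensorProduct.tmul_add, hx, hy]
    | tmul z w =>
      induction z using hom_ind (𝒜 := 𝒜) with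
      | hadd x y hx hy => simp only [map_add, TensorProduct.add_tmul, TensorProduct.tmul_add, hx, hy]
      | hom j z hz =>
        rw [TensorProduct.map_tmul, Fa_hom H a z j hz]
        simp only [cnv, LinearMap.comp_apply]
        induction H.comul a with
        | zero => simp
        | add x y hx hy =>
          simp only [map_add, TensorProduct.add_tmul, ← hx, ← hy]
        | tmul x y => rw [superMul_tw j x y z w hz]; simp [mul_assoc]
  have h2 := LinearMap.congr_fun (anti_left H) (a * b)
  simp only [cnv, LinearMap.comp_apply, comul_mul'] at h2 ⊢
  rw [key, h2]
  simp [cu, H.counit_mul, Algebra.algebraMap_eq_smul_one, smul_smul, mul_comm]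

theorem Fa_eq (H : SuperHopf K A 𝒜) (a : A) :
    Fa H a = H.counit a • H.antipode := by
  have h := congrArg (fun f => cnv H f H.antipode) (Fa_cnv H a)
  simp only [cnv_assoc, anti_right, cnv_cu, cu_cnv] at h
  ext b
  simpa [Algebra.smul_def] using LinearMap.congr_fun h b

theorem anti_mul_tw (H : SuperHopf K A 𝒜) (a b : A) (j : ZMod 2) (hb : b ∈ 𝒜 j) :
    H.antipode (a * b) = H.antipode b * tw 𝒜 j (H.antipode a) := by
  have h1 : cnv H (H.antipode ∘ₗ LinearMap.mulRight K b) (tw 𝒜 j) = cu H (H.antipode b) := by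
    ext a
    rw [← Fa_hom H a b j hb, Fa_eq]; simp [cu]
  have h2 : cnv H (tw 𝒜 j) (tw 𝒜 j ∘ₗ H.antipode) = cu H 1 := by
    have := comp_cnv H (tw 𝒜 j) (tw_mul j) LinearMap.id H.antipode
    rw [anti_right, comp_cu, tw_one] at this
    rw [this]; rfl
  have h := congrArg (fun f => cnv H f (tw 𝒜 j ∘ₗ H.antipode)) h1
  simp only [cnv_assoc, h2, cnv_cu, cu_cnv] at h
  simpa using LinearMap.congr_fun h a

theorem anti_mul (hcomm : ∀ (i j : ZMod 2) (a b : A), a ∈ 𝒜 i → b ∈ 𝒜 j →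
      a * b = ((-1 : K) ^ (i.val * j.val)) • (b * a))
    (H : SuperHopf K A 𝒜) (a b : A) :
    H.antipode (a * b) = H.antipode a * H.antipode b := by
  induction a using hom_ind (𝒜 := 𝒜) with
  | hadd x y hx hy => simp only [add_mul, map_add, hx, hy]
  | hom i a ha =>
    induction b using hom_ind (𝒜 := 𝒜) with
    | hadd x y hx hy => simp only [mul_add, map_add, hx, hy]
    | hom j b hb =>
      have h1 := H.antipode_graded i a ha
      have h2 := H.antipode_graded j b hb
      rw [anti_mul_tw H a b j hb, tw_of_mem i j _ h1, hcomm i j _ _ h1 h2, mul_smul_comm]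

theorem cnv_mul (𝒜' : ZMod 2 → Submodule K B)
    (hcomm' : ∀ (i j : ZMod 2) (a b : B), a ∈ 𝒜' i → b ∈ 𝒜' j →
      a * b = ((-1 : K) ^ (i.val * j.val)) • (b * a))
    (H : SuperHopf K A 𝒜) (f g : A →ₗ[K] B)
    (hf : ∀ x y, f (x * y) = f x * f y) (hg : ∀ x y, g (x * y) = g x * g y)
    (hf' : ∀ (i : ZMod 2), ∀ x ∈ 𝒜 i, f x ∈ 𝒜' i)
    (hg' : ∀ (i : ZMod 2), ∀ x ∈ 𝒜 i, g x ∈ 𝒜' i) (a b : A) :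
    cnv H f g (a * b) = cnv H f g a * cnv H f g b := by
  simp only [cnv, LinearMap.comp_apply, comul_mul']
  induction H.comul a with
  | zero => simp
  | add x y hx hy => simp only [map_add, TensorProduct.add_tmul, add_mul, hx, hy]
  | tmul x y =>
    induction H.comul b with
    | zero => simp
    | add x y hx hy => simp only [map_add, TensorProduct.tmul_add, mul_add, hx, hy]
    | tmul z w =>
      induction y using hom_ind (𝒜 := 𝒜) with
      | hadd _ _ hx hy =>
        simp only [map_add, TensorProduct.tmul_add, TensorProduct.add_tmul, add_mul, hx, hy]
      | hom i y hy =>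
        induction z using hom_ind (𝒜 := 𝒜) with
        | hadd _ _ hx hy =>
          simp only [map_add, TensorProduct.tmul_add, TensorProduct.add_tmul, mul_add, hx, hy]
        | hom j z hz =>
          rw [superMul_hom i j x y z w hy hz]
          simp only [map_smul, TensorProduct.map_tmul, LinearMap.mul'_apply, hf, hg]
          have := hcomm' i j _ _ (hg' i y hy) (hf' j z hz)
          rw [mul_assoc (f x) (g y), ← mul_assoc (g y), this]
          simp [mul_assoc]

theorem coideal (H : SuperHopf K A 𝒜) (I T : Submodule K A)
    (hT : T = LinearMap.ker
      ((TensorProduct.map LinearMap.id I.mkQ ∘ₗ H.comul) -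
        (TensorProduct.mk K A (A ⧸ I)).flip (I.mkQ 1)))
    (t : A) (ht : t ∈ T) :
    H.comul t ∈ LinearMap.range (T.subtype.lTensor A) := by
  set D := ((TensorProduct.map LinearMap.id I.mkQ ∘ₗ H.comul) -
        (TensorProduct.mk K A (A ⧸ I)).flip (I.mkQ 1)) with hD
  have hex : Function.Exact T.subtype D := by
    intro x
    rw [← LinearMap.mem_ker, ← hT]; simp
  have hex2 := Module.Flat.lTensor_exact A hex
  refine (hex2 _).1 ?_
  have ht' : TensorProduct.map LinearMap.id I.mkQ (H.comul t) = t ⊗ₜ[K] I.mkQ 1 := by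
    rw [hT, LinearMap.mem_ker, hD] at ht
    simpa [sub_eq_zero] using ht
  have e1 : ∀ u : A ⊗[K] A, TensorProduct.map LinearMap.id
      (TensorProduct.map LinearMap.id I.mkQ) (TensorProduct.assoc K A A A
        (TensorProduct.map H.comul LinearMap.id u)) =
      TensorProduct.assoc K A A (A ⧸ I) (TensorProduct.map H.comul LinearMap.id
        (TensorProduct.map LinearMap.id I.mkQ u)) := by
    intro u
    induction u with
    | zero => simp
    | add x y hx hy => simp only [map_add, hx, hy]
    | tmul x y =>
      simp only [TensorProduct.map_tmul, LinearMap.id_apply]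
      induction H.comul x with
      | zero => simp
      | add x y hx hy => simp only [map_add, TensorProduct.add_tmul, hx, hy]
      | tmul a b => simp
  have e2 : ∀ u : A ⊗[K] A, D.lTensor A u = TensorProduct.map LinearMap.id
      (TensorProduct.map LinearMap.id I.mkQ) (TensorProduct.map LinearMap.id H.comul u) -
      TensorProduct.assoc K A A (A ⧸ I) (u ⊗ₜ[K] I.mkQ 1) := by
    intro u
    induction u with
    | zero => simp
    | add x y hx hy => simp only [map_add, TensorProduct.add_tmul, hx, hy]; abel
    | tmul x y => simp [hD, TensorProduct.tmul_sub]
  have hc := LinearMap.congr_fun H.coassoc t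
  simp only [LinearMap.comp_apply, LinearEquiv.coe_coe] at hc
  rw [e2, ← hc, e1, ht']
  simp

theorem cnv_vanish (H : SuperHopf K A 𝒜) (I T : Submodule K A)
    (hT : T = LinearMap.ker
      ((TensorProduct.map LinearMap.id I.mkQ ∘ₗ H.comul) -
        (TensorProduct.mk K A (A ⧸ I)).flip (I.mkQ 1)))
    (g₁ g₂ : A →ₐ[K] B) (hagree : ∀ t ∈ T, g₁ t = g₂ t)
    (t : A) (ht : t ∈ T) (h0 : H.counit t = 0) :
    cnv H (g₁.toLinearMap ∘ₗ H.antipode) g₂.toLinearMap t = 0 := by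
  have h1 : cnv H (g₁.toLinearMap ∘ₗ H.antipode) g₂.toLinearMap t =
      cnv H (g₁.toLinearMap ∘ₗ H.antipode) g₁.toLinearMap t := by
    obtain ⟨u, hu⟩ := coideal H I T hT t ht
    simp only [cnv, LinearMap.comp_apply, ← hu]
    clear hu
    induction u with
    | zero => simp
    | add x y hx hy => simp only [map_add, hx, hy]
    | tmul x y => simp [hagree y y.2]
  have h2 := comp_cnv H g₁.toLinearMap (by simp) H.antipode LinearMap.id
  rw [anti_left, comp_cu] at h2
  rw [h1]
  have h3 := LinearMap.congr_fun h2 t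
  rw [LinearMap.comp_id] at h3
  rw [← h3]; simp [cu, h0]

end Helpers

/-- let N ≤ G be a supersubgroup whose defining superideal is
I_N = K[G]T⁺ + K[G]s(T⁺), where T = K[G]^N. If two A-points g₁, g₂ ∈ G(A) agree on T,
then the convolution g₁⁻¹g₂ = (g₁ ∘ s) * g₂ vanishes on I_N, i.e. g₁N(A) = g₂N(A). -/
theorem points_agreeing_on_invariants_lie_in_same_coset
    {K A : Type} [Field K] (hK : (2 : K) ≠ 0)
    [Ring A] [Algebra K A] (𝒜 : ZMod 2 → Submodule K A) [GradedAlgebra 𝒜]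
    (hcomm : ∀ (i j : ZMod 2) (a b : A), a ∈ 𝒜 i → b ∈ 𝒜 j →
      a * b = ((-1 : K) ^ (i.val * j.val)) • (b * a))
    (H : SuperHopf K A 𝒜)
    (I : Submodule K A)
    -- T = K[G]^N, the right N-invariants of K[G] (where K[N] = K[G]/I):
    (T : Submodule K A)
    (hT : T = LinearMap.ker
      ((TensorProduct.map LinearMap.id I.mkQ ∘ₗ H.comul) -
        (TensorProduct.mk K A (A ⧸ I)).flip (I.mkQ 1)))
    -- the hypothesis I_N = K[G]·T⁺ + K[G]·s(T⁺):
    (hI : I = Submodule.span K {x : A | ∃ a t : A, t ∈ T ∧ H.counit t = 0 ∧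
      (x = a * t ∨ x = a * H.antipode t)})
    -- an arbitrary commutative superalgebra A' and two A'-points of G:
    {A' : Type} [Ring A'] [Algebra K A']
    (𝒜' : ZMod 2 → Submodule K A')
    (hcomm' : ∀ (i j : ZMod 2) (a b : A'), a ∈ 𝒜' i → b ∈ 𝒜' j →
      a * b = ((-1 : K) ^ (i.val * j.val)) • (b * a))
    (g₁ g₂ : A →ₐ[K] A')
    (hg₁ : ∀ (i : ZMod 2), ∀ x ∈ 𝒜 i, g₁ x ∈ 𝒜' i)
    (hg₂ : ∀ (i : ZMod 2), ∀ x ∈ 𝒜 i, g₂ x ∈ 𝒜' i)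
    (hagree : ∀ t ∈ T, g₁ t = g₂ t) :
    ∀ x ∈ I, LinearMap.mul' K A'
      (TensorProduct.map (g₁.toLinearMap ∘ₗ H.antipode) g₂.toLinearMap
        (H.comul x)) = 0 := by
  have hs := anti_mul hcomm H
  set φ := cnv H (g₁.toLinearMap ∘ₗ H.antipode) g₂.toLinearMap with hφ
  set ψ := cnv H (g₂.toLinearMap ∘ₗ H.antipode) g₁.toLinearMap with hψ
  have hφm : ∀ a b, φ (a * b) = φ a * φ b :=
    cnv_mul 𝒜' hcomm' H _ _ (by simp [hs]) (by simp)
      (fun i x hx => hg₁ i _ (H.antipode_graded i x hx)) hg₂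
  have hA : ∀ g : A →ₐ[K] A', cnv H (g.toLinearMap ∘ₗ H.antipode) g.toLinearMap = cu H 1 := by
    intro g
    have h2 := comp_cnv H g.toLinearMap (by simp) H.antipode LinearMap.id
    rw [anti_left, comp_cu, LinearMap.comp_id] at h2
    rw [← h2]; simp
  have hB : ∀ g : A →ₐ[K] A', cnv H g.toLinearMap (g.toLinearMap ∘ₗ H.antipode) = cu H 1 := by
    intro g
    have h2 := comp_cnv H g.toLinearMap (by simp) LinearMap.id H.antipode
    rw [anti_right, comp_cu, LinearMap.comp_id] at h2
    rw [← h2]; simp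
  have hone : ∀ f : A →ₗ[K] A', cnv H (cu H 1) f = f := by
    intro f; rw [cu_cnv]; ext x; simp
  have hone' : ∀ f : A →ₗ[K] A', cnv H f (cu H 1) = f := by
    intro f; rw [cnv_cu]; ext x; simp
  have hφψ : cnv H φ ψ = cu H 1 := by
    rw [hφ, hψ, cnv_assoc, ← cnv_assoc H g₂.toLinearMap, hB, hone, hA]
  have hc1 : H.comul 1 = 1 ⊗ₜ[K] 1 := H.comul_one
  have hs1 : H.antipode 1 = 1 := by
    have := LinearMap.congr_fun (anti_left H) 1
    simpa [cnv, cu, hc1, H.counit_one] using this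
  have hφ1 : φ 1 = 1 := by simp [hφ, cnv, hc1, hs1]
  have hφs : φ ∘ₗ H.antipode = ψ := by
    have h2 := comp_cnv H φ hφm H.antipode LinearMap.id
    rw [anti_left, comp_cu, LinearMap.comp_id, hφ1] at h2
    have h3 := congrArg (fun f => cnv H f ψ) h2
    simp only [cnv_assoc, hφψ, hone, hone'] at h3
    exact h3.symm
  intro x hx
  change φ x = 0
  rw [hI] at hx
  induction hx using Submodule.span_induction with
  | mem x hx =>
    obtain ⟨a, t, ht, h0, rfl | rfl⟩ := hx
    · rw [hφm, hφ, cnv_vanish H I T hT g₁ g₂ hagree t ht h0, mul_zero]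
    · have : φ (H.antipode t) = ψ t := LinearMap.congr_fun hφs t
      rw [hφm, this, hψ,
        cnv_vanish H I T hT g₂ g₁ (fun t ht => (hagree t ht).symm) t ht h0, mul_zero]
  | zero => simp
  | add x y _ _ hx hy => rw [map_add, hx, hy, add_zero]
  | smul c x _ hx => rw [map_smul, hx, smul_zero]
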